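/- arXiv:2303.07918 — 2 statements merged into one kernel-verified Lean document; each statement's English description precedes it below -/
import Mathlib

section
/- Let S ∈ ℝ^{d×d} be invertible with condition number κ = ‖S⁻¹‖‖S‖ (spectral norms). Then for all s-dimensional subspaces V, W of ℝ^d and all 1 ≤ s ≤ d, the maximal principal angle satisfies ∠(SV, SW) ≤ πκ(1+κ) ∠(V,W). -/
open scoped Matrix RealInnerProductSpace
open Module Real

noncomputable def maxAngle {d : ℕ} (V W : Submodule ℝ (EuclideanSpace ℝ (Fin d))) : ℝ :=
  Real.arccos (sInf {r : ℝ | ∃ v ∈ V, ‖v‖ = 1 ∧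
    r = sSup {c : ℝ | ∃ w ∈ W, ‖w‖ = 1 ∧ c = ⟪v, w⟫}})

/-- The spectral norm of a real matrix. -/
noncomputable def sNorm {m n : ℕ} (A : Matrix (Fin m) (Fin n) ℝ) : ℝ :=
  ‖LinearMap.toContinuousLinearMap (Matrix.toEuclideanLin A)‖

/-- The image `SV = {Sv : v ∈ V}` of a subspace under a matrix. -/
noncomputable def mapMat {d : ℕ} (S : Matrix (Fin d) (Fin d) ℝ)
    (V : Submodule ℝ (EuclideanSpace ℝ (Fin d))) : Submodule ℝ (EuclideanSpace ℝ (Fin d)) :=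
  V.map (Matrix.toEuclideanLin S)


lemma sSup_inner_eq {d : ℕ} (W : Submodule ℝ (EuclideanSpace ℝ (Fin d))) (hW : W ≠ ⊥)
    (v : EuclideanSpace ℝ (Fin d)) :
    sSup {c : ℝ | ∃ w ∈ W, ‖w‖ = 1 ∧ c = ⟪v, w⟫} = ‖W.starProjection v‖ := by
  have key : ∀ w ∈ W, ⟪v, w⟫ = ⟪W.starProjection v, w⟫ := by
    intro w hw
    have h := Submodule.starProjection_inner_eq_zero v w hw
    rw [inner_sub_left] at h
    linarith
  apply IsGreatest.csSup_eq
  constructor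
  · by_cases h0 : W.starProjection v = 0
    · obtain ⟨x, hx, hx0⟩ := Submodule.exists_mem_ne_zero_of_ne_bot hW
      refine ⟨(‖x‖⁻¹ : ℝ) • x, W.smul_mem _ hx, norm_smul_inv_norm hx0, ?_⟩
      rw [key _ (W.smul_mem _ hx), h0]
      simp
    · have hm := Submodule.starProjection_apply_mem W v
      refine ⟨(‖W.starProjection v‖⁻¹ : ℝ) • W.starProjection v, W.smul_mem _ hm,
        norm_smul_inv_norm h0, ?_⟩
      rw [key _ (W.smul_mem _ hm), inner_smul_right, real_inner_self_eq_norm_sq]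
      have : ‖W.starProjection v‖ ≠ 0 := norm_ne_zero_iff.mpr h0
      field_simp
  · rintro c ⟨w, hw, hw1, rfl⟩
    rw [key w hw]
    have := real_inner_le_norm (W.starProjection v) w
    rwa [hw1, mul_one] at this

lemma proj_pyth {d : ℕ} (W : Submodule ℝ (EuclideanSpace ℝ (Fin d)))
    (v : EuclideanSpace ℝ (Fin d)) :
    ‖v - W.starProjection v‖ ^ 2 + ‖W.starProjection v‖ ^ 2 = ‖v‖ ^ 2 := by
  have h := Submodule.starProjection_inner_eq_zero v _ (Submodule.starProjection_apply_mem W v)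
  have h2 := norm_add_sq_real (v - W.starProjection v) (W.starProjection v)
  rw [h, sub_add_cancel] at h2
  linarith

lemma proj_le {d : ℕ} (W : Submodule ℝ (EuclideanSpace ℝ (Fin d)))
    (v w : EuclideanSpace ℝ (Fin d)) (hw : w ∈ W) :
    ‖v - W.starProjection v‖ ≤ ‖v - w‖ := by
  have h := Submodule.starProjection_inner_eq_zero v _
    (W.sub_mem (Submodule.starProjection_apply_mem W v) hw)
  have h2 := norm_add_sq_real (v - W.starProjection v) (W.starProjection v - w)
  rw [h, sub_add_sub_cancel] at h2
  apply (sq_le_sq₀ (norm_nonneg _) (norm_nonneg _)).mp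
  nlinarith [sq_nonneg ‖W.starProjection v - w‖]

lemma sInf_set_eq {d : ℕ} (V W : Submodule ℝ (EuclideanSpace ℝ (Fin d))) (hW : W ≠ ⊥) :
    maxAngle V W = Real.arccos (sInf {r : ℝ | ∃ v ∈ V, ‖v‖ = 1 ∧ r = ‖W.starProjection v‖}) := by
  unfold maxAngle
  simp only [sSup_inner_eq W hW]

lemma sInf_set_nonneg {d : ℕ} (V W : Submodule ℝ (EuclideanSpace ℝ (Fin d))) :
    0 ≤ sInf {r : ℝ | ∃ v ∈ V, ‖v‖ = 1 ∧ r = ‖W.starProjection v‖} := by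
  apply Real.sInf_nonneg
  rintro r ⟨v, _, _, rfl⟩
  exact norm_nonneg _

lemma dist_le_sin {d : ℕ} (V W : Submodule ℝ (EuclideanSpace ℝ (Fin d))) (hW : W ≠ ⊥)
    (v : EuclideanSpace ℝ (Fin d)) (hv : v ∈ V) (hv1 : ‖v‖ = 1) :
    ‖v - W.starProjection v‖ ≤ Real.sin (maxAngle V W) := by
  rw [sInf_set_eq V W hW, Real.sin_arccos]
  apply Real.le_sqrt_of_sq_le
  have h0 := sInf_set_nonneg V W
  have h1 : sInf {r : ℝ | ∃ v ∈ V, ‖v‖ = 1 ∧ r = ‖W.starProjection v‖}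
      ≤ ‖W.starProjection v‖ := by
    apply csInf_le
    · refine ⟨0, ?_⟩
      rintro r ⟨v, _, _, rfl⟩
      exact norm_nonneg _
    · exact ⟨v, hv, hv1, rfl⟩
  have := proj_pyth W v
  rw [hv1] at this
  nlinarith

lemma sin_le_of_dist {d : ℕ} (V W : Submodule ℝ (EuclideanSpace ℝ (Fin d))) (hV : V ≠ ⊥)
    (hW : W ≠ ⊥) (t : ℝ) (ht : 0 ≤ t)
    (h : ∀ v ∈ V, ‖v‖ = 1 → ‖v - W.starProjection v‖ ≤ t) :
    Real.sin (maxAngle V W) ≤ t := by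
  rw [sInf_set_eq V W hW, Real.sin_arccos]
  apply Real.sqrt_le_iff.mpr ⟨ht, ?_⟩
  have h0 := sInf_set_nonneg V W
  have h1 : √(1 - t ^ 2) ≤ sInf {r : ℝ | ∃ v ∈ V, ‖v‖ = 1 ∧ r = ‖W.starProjection v‖} := by
    apply le_csInf
    · obtain ⟨x, hx, hx0⟩ := Submodule.exists_mem_ne_zero_of_ne_bot hV
      exact ⟨_, (‖x‖⁻¹ : ℝ) • x, V.smul_mem _ hx, norm_smul_inv_norm hx0, rfl⟩
    · rintro r ⟨v, hv, hv1, rfl⟩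
      apply Real.sqrt_le_iff.mpr ⟨norm_nonneg _, ?_⟩
      have h2 := proj_pyth W v
      have h3 := h v hv hv1
      rw [hv1] at h2
      nlinarith [norm_nonneg (v - W.starProjection v)]
  have := (Real.sqrt_le_left h0).mp h1
  linarith

lemma maxAngle_le {d : ℕ} (V W : Submodule ℝ (EuclideanSpace ℝ (Fin d))) (hW : W ≠ ⊥) :
    maxAngle V W ≤ π / 2 := by
  rw [sInf_set_eq V W hW]
  exact Real.arccos_le_pi_div_two.mpr (sInf_set_nonneg V W)

/-- Angle bound for linear maps: if `S` is invertible with condition number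
`κ = ‖S⁻¹‖‖S‖`, then `∠(SV, SW) ≤ πκ(1+κ)∠(V,W)` for all `s`-dimensional
subspaces `V, W` of `ℝ^d`, `1 ≤ s ≤ d`. -/
theorem stmt4 (d : ℕ) (S : Matrix (Fin d) (Fin d) ℝ) (hS : IsUnit S)
    (κ : ℝ) (hκ : κ = sNorm S⁻¹ * sNorm S) :
    ∀ s : ℕ, 1 ≤ s → s ≤ d →
      ∀ V W : Submodule ℝ (EuclideanSpace ℝ (Fin d)),
        finrank ℝ V = s → finrank ℝ W = s →
        maxAngle (mapMat S V) (mapMat S W) ≤ π * κ * (1 + κ) * maxAngle V W := by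
  intro s hs _ V W hVs hWs
  have hV : V ≠ ⊥ := by
    rintro rfl
    simp at hVs
    omega
  have hW : W ≠ ⊥ := by
    rintro rfl
    simp at hWs
    omega
  have hdet : IsUnit S.det := (Matrix.isUnit_iff_isUnit_det S).mp hS
  have hinv : ∀ x, Matrix.toEuclideanLin S⁻¹ (Matrix.toEuclideanLin S x) = x := by
    intro x
    simp [Matrix.toEuclideanLin, Matrix.toLpLin_apply, Matrix.mulVec_mulVec, Matrix.nonsing_inv_mul S hdet]
  have hinj : Function.Injective (Matrix.toEuclideanLin S) :=
    Function.LeftInverse.injective hinv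
  have hbot : ∀ U : Submodule ℝ (EuclideanSpace ℝ (Fin d)), U ≠ ⊥ → mapMat S U ≠ ⊥ := by
    intro U hU h
    apply hU
    unfold mapMat at h
    exact Submodule.map_injective_of_injective hinj (h.trans (Submodule.map_bot _).symm)
  have hn : ∀ (A : Matrix (Fin d) (Fin d) ℝ) x, ‖Matrix.toEuclideanLin A x‖ ≤ sNorm A * ‖x‖ := by
    intro A x
    exact (LinearMap.toContinuousLinearMap (Matrix.toEuclideanLin A)).le_opNorm x
  have hA0 : ∀ (A : Matrix (Fin d) (Fin d) ℝ), 0 ≤ sNorm A := fun A => norm_nonneg _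
  have hκ0 : 0 ≤ κ := hκ ▸ mul_nonneg (hA0 _) (hA0 _)
  have hθ0 : 0 ≤ maxAngle V W := Real.arccos_nonneg _
  have hθ'0 : 0 ≤ maxAngle (mapMat S V) (mapMat S W) := Real.arccos_nonneg _
  have hs0 : 0 ≤ Real.sin (maxAngle V W) :=
    Real.sin_nonneg_of_nonneg_of_le_pi hθ0 (Real.arccos_le_pi _)
  -- distances scale linearly
  have hdist : ∀ v ∈ V, ‖v - W.starProjection v‖ ≤ Real.sin (maxAngle V W) * ‖v‖ := by
    intro v hv
    by_cases h0 : v = 0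
    · simp [h0]
    have hne : 0 < ‖v‖ := norm_pos_iff.mpr h0
    have h := dist_le_sin V W hW ((‖v‖⁻¹ : ℝ) • v) (V.smul_mem _ hv) (norm_smul_inv_norm h0)
    rw [map_smul, ← smul_sub, norm_smul, norm_inv, norm_norm, inv_mul_le_iff₀ hne] at h
    linarith
  have hsin : Real.sin (maxAngle (mapMat S V) (mapMat S W)) ≤ κ * Real.sin (maxAngle V W) := by
    apply sin_le_of_dist _ _ (hbot V hV) (hbot W hW) _ (mul_nonneg hκ0 hs0)
    rintro y ⟨v, hv, rfl⟩ hy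
    have h1 := proj_le (mapMat S W) (Matrix.toEuclideanLin S v)
      (Matrix.toEuclideanLin S (W.starProjection v))
      (Submodule.mem_map_of_mem (Submodule.starProjection_apply_mem W v))
    rw [← map_sub] at h1
    have h2 := hn S (v - W.starProjection v)
    have h3 := hn S⁻¹ (Matrix.toEuclideanLin S v)
    rw [hinv, hy, mul_one] at h3
    have h4 := hdist v hv
    calc _ ≤ sNorm S * ‖v - W.starProjection v‖ := h1.trans h2
      _ ≤ sNorm S * (Real.sin (maxAngle V W) * sNorm S⁻¹) := by
        apply mul_le_mul_of_nonneg_left _ (hA0 S)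
        exact h4.trans (mul_le_mul_of_nonneg_left h3 hs0)
      _ = κ * Real.sin (maxAngle V W) := by rw [hκ]; ring
  have hj := Real.mul_le_sin hθ'0 (maxAngle_le _ _ (hbot W hW))
  have hsl := Real.sin_le hθ0
  have h5 : 2 / π * maxAngle (mapMat S V) (mapMat S W) ≤ κ * maxAngle V W :=
    hj.trans (hsin.trans (mul_le_mul_of_nonneg_left hsl hκ0))
  have hpi := Real.pi_pos
  have h6 : 2 * maxAngle (mapMat S V) (mapMat S W) ≤ π * (κ * maxAngle V W) := by
    rw [div_mul_eq_mul_div, div_le_iff₀ hpi] at h5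
    linarith
  have h7 : 0 ≤ π * (κ * maxAngle V W) := by positivity
  have h8 : 0 ≤ π * (κ * maxAngle V W) * κ := by positivity
  nlinarith
end

section
/- For all s-dimensional subspaces V, W of ℝ^d and every matrix S ∈ ℝ^{d×d} such that SV is again s-dimensional, the maximal principal angle satisfies the global Lipschitz estimate |∠(SV, W) − ∠(V, W)| ≤ C ‖S − I_d‖ with the explicit constant C = π/2 + √(π²/4 + 1), where ‖·‖ is the spectral norm. -/
open scoped Matrix RealInnerProductSpace
open Module Real

lemma inner_nonneg_imp_angle {E : Type*} [NormedAddCommGroup E] [InnerProductSpace ℝ E]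
    (x y : E) (h : 0 ≤ ⟪x, y⟫) : InnerProductGeometry.angle x y ≤ π / 2 := by
  unfold InnerProductGeometry.angle
  rw [Real.arccos_le_pi_div_two]
  positivity

lemma angle_le_of_near {E : Type*} [NormedAddCommGroup E] [InnerProductSpace ℝ E]
    (x y : E) (ε : ℝ) (hx : x ≠ 0) (hy : y ≠ 0) (h1 : ε < 1) (h : ‖x - y‖ ≤ ε * ‖x‖) :
    InnerProductGeometry.angle x y ≤ π / 2 * ε := by
  have hxp : 0 < ‖x‖ := norm_pos_iff.2 hx
  have hyp : 0 < ‖y‖ := norm_pos_iff.2 hy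
  have hε : 0 ≤ ε := by
    by_contra hneg
    have := norm_nonneg (x - y)
    nlinarith
  have hsq : ‖x - y‖ ^ 2 = ‖x‖ ^ 2 - 2 * ⟪x, y⟫ + ‖y‖ ^ 2 := norm_sub_sq_real x y
  have hin : 0 ≤ ⟪x, y⟫ := by
    have h2 : ‖x - y‖ ≤ ‖x‖ := by nlinarith
    have h3 : ‖x - y‖ ^ 2 ≤ ‖x‖ ^ 2 := pow_le_pow_left₀ (norm_nonneg _) h2 2
    nlinarith [sq_nonneg ‖y‖]
  set a := InnerProductGeometry.angle x y with ha
  have ha0 : 0 ≤ a := InnerProductGeometry.angle_nonneg x y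
  have ha2 : a ≤ π / 2 := inner_nonneg_imp_angle x y hin
  have hc : Real.cos a * (‖x‖ * ‖y‖) = ⟪x, y⟫ :=
    InnerProductGeometry.cos_angle_mul_norm_mul_norm x y
  have hs0 : 0 ≤ Real.sin a := Real.sin_nonneg_of_nonneg_of_le_pi ha0 (by linarith [Real.pi_pos])
  have hs : Real.sin a * ‖x‖ ≤ ε * ‖x‖ := by
    refine le_trans ?_ h
    refine abs_le_of_sq_le_sq' ?_ (norm_nonneg _) |>.2
    have := Real.sin_sq_add_cos_sq a
    have e : (Real.sin a * ‖x‖) ^ 2 = ‖x‖ ^ 2 - (Real.cos a * ‖x‖) ^ 2 := by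
      have : Real.sin a ^ 2 = 1 - Real.cos a ^ 2 := by linarith
      rw [mul_pow, this]; ring
    rw [e, hsq, ← hc]
    nlinarith [sq_nonneg (‖y‖ - Real.cos a * ‖x‖)]
  have hs' : Real.sin a ≤ ε := le_of_mul_le_mul_right hs hxp
  have hj := Real.mul_le_sin ha0 ha2
  have : 2 / π * a ≤ ε := hj.trans hs'
  have hp := Real.pi_pos
  calc a = π / 2 * (2 / π * a) := by field_simp
    _ ≤ π / 2 * ε := by gcongr

section
variable {d : ℕ}

lemma angle_unit {v w : EuclideanSpace ℝ (Fin d)} (hv : ‖v‖ = 1) (hw : ‖w‖ = 1) :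
    InnerProductGeometry.angle v w = Real.arccos ⟪v, w⟫ := by
  simp [InnerProductGeometry.angle, hv, hw]

lemma inner_unit_le {v w : EuclideanSpace ℝ (Fin d)} (hv : ‖v‖ = 1) (hw : ‖w‖ = 1) :
    ⟪v, w⟫ ≤ 1 := by
  have := real_inner_le_norm v w
  rwa [hv, hw, mul_one] at this

lemma neg_le_inner_unit {v w : EuclideanSpace ℝ (Fin d)} (hv : ‖v‖ = 1) (hw : ‖w‖ = 1) :
    -1 ≤ ⟪v, w⟫ := by
  have := neg_le_of_abs_le (abs_real_inner_le_norm v w)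
  rwa [hv, hw, mul_one] at this

lemma exists_unit (V : Submodule ℝ (EuclideanSpace ℝ (Fin d))) (hV : V ≠ ⊥) :
    ∃ v ∈ V, ‖v‖ = 1 := by
  obtain ⟨v, hv, h0⟩ := V.ne_bot_iff.1 hV
  exact ⟨(‖v‖)⁻¹ • v, V.smul_mem _ hv, norm_smul_inv_norm (𝕜 := ℝ) h0⟩

lemma bdd_inner (W : Submodule ℝ (EuclideanSpace ℝ (Fin d)))
    {v : EuclideanSpace ℝ (Fin d)} (hv : ‖v‖ = 1) :
    BddAbove {c : ℝ | ∃ w ∈ W, ‖w‖ = 1 ∧ c = ⟪v, w⟫} := by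
  refine ⟨1, ?_⟩
  rintro c ⟨w, -, hw, rfl⟩
  exact inner_unit_le hv hw

lemma maxAngle_exists (V W : Submodule ℝ (EuclideanSpace ℝ (Fin d))) (hW : W ≠ ⊥)
    (v : EuclideanSpace ℝ (Fin d)) (hvV : v ∈ V) (hv : ‖v‖ = 1) :
    ∃ w ∈ W, ‖w‖ = 1 ∧ InnerProductGeometry.angle v w ≤ maxAngle V W := by
  have hcpt : IsCompact ((W : Set (EuclideanSpace ℝ (Fin d))) ∩ Metric.sphere 0 1) :=
    (isCompact_sphere 0 1).inter_left W.closed_of_finiteDimensional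
  obtain ⟨w0, hw0, hw0n⟩ := exists_unit W hW
  obtain ⟨w, ⟨hwW, hw⟩, hmax⟩ := hcpt.exists_isMaxOn (f := fun w => ⟪v, w⟫)
    ⟨w0, hw0, by simpa using hw0n⟩ (by fun_prop)
  have hw1 : ‖w‖ = 1 := by simpa using hw
  refine ⟨w, hwW, hw1, ?_⟩
  rw [angle_unit hv hw1]
  refine Real.arccos_le_arccos ?_
  have hsup : sSup {c : ℝ | ∃ w ∈ W, ‖w‖ = 1 ∧ c = ⟪v, w⟫} ≤ ⟪v, w⟫ := by
    refine csSup_le ⟨_, w0, hw0, hw0n, rfl⟩ ?_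
    rintro c ⟨u, hu, hu1, rfl⟩
    exact hmax ⟨hu, by simpa using hu1⟩
  refine le_trans (csInf_le ⟨-1, ?_⟩ ⟨v, hvV, hv, rfl⟩) hsup
  rintro r ⟨x, -, hx, rfl⟩
  exact (neg_le_inner_unit hx hw0n).trans (le_csSup (bdd_inner W hx) ⟨w0, hw0, hw0n, rfl⟩)

lemma maxAngle_le_s7 (V W : Submodule ℝ (EuclideanSpace ℝ (Fin d))) (hV : V ≠ ⊥) (t : ℝ)
    (h : ∀ v ∈ V, ‖v‖ = 1 → ∃ w ∈ W, ‖w‖ = 1 ∧ InnerProductGeometry.angle v w ≤ t) :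
    maxAngle V W ≤ t := by
  obtain ⟨v0, hv0, hv0n⟩ := exists_unit V hV
  have ht0 : 0 ≤ t := by
    obtain ⟨w, -, -, hw⟩ := h v0 hv0 hv0n
    exact (InnerProductGeometry.angle_nonneg _ _).trans hw
  rcases le_total π t with hpi | hpi
  · exact (Real.arccos_le_pi _).trans hpi
  rw [← Real.arccos_cos ht0 hpi]
  refine Real.arccos_le_arccos ?_
  refine le_csInf ⟨_, v0, hv0, hv0n, rfl⟩ ?_
  rintro r ⟨v, hv, hvn, rfl⟩
  obtain ⟨w, hw, hwn, hle⟩ := h v hv hvn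
  refine le_trans ?_ (le_csSup (bdd_inner W hvn) ⟨w, hw, hwn, rfl⟩)
  have := Real.cos_le_cos_of_nonneg_of_le_pi (InnerProductGeometry.angle_nonneg _ _) hpi hle
  rw [InnerProductGeometry.cos_angle, hvn, hwn] at this
  simpa using this

lemma maxAngle_le_half (V W : Submodule ℝ (EuclideanSpace ℝ (Fin d))) (hV : V ≠ ⊥)
    (hW : W ≠ ⊥) : maxAngle V W ≤ π / 2 := by
  refine maxAngle_le_s7 V W hV _ ?_
  intro v hv hvn
  obtain ⟨w, hw, hwn⟩ := exists_unit W hW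
  rcases le_total 0 (⟪v, w⟫) with h | h
  · exact ⟨w, hw, hwn, (inner_nonneg_imp_angle v w) h⟩
  · refine ⟨-w, W.neg_mem hw, by rwa [norm_neg],
      (inner_nonneg_imp_angle v (-w)) ?_⟩
    rw [inner_neg_right]; linarith

lemma maxAngle_tri (X Y W : Submodule ℝ (EuclideanSpace ℝ (Fin d))) (hX : X ≠ ⊥)
    (hW : W ≠ ⊥) (t : ℝ)
    (h : ∀ x ∈ X, x ≠ 0 → ∃ y ∈ Y, y ≠ 0 ∧ InnerProductGeometry.angle x y ≤ t) :
    maxAngle X W ≤ maxAngle Y W + t := by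
  refine maxAngle_le_s7 X W hX _ ?_
  intro x hx hxn
  obtain ⟨y, hy, hy0, hxy⟩ := h x hx (by rintro rfl; simp at hxn)
  obtain ⟨w, hw, hwn, hyw⟩ := maxAngle_exists Y W hW ((‖y‖)⁻¹ • y) (Y.smul_mem _ hy)
    (norm_smul_inv_norm (𝕜 := ℝ) hy0)
  rw [InnerProductGeometry.angle_smul_left_of_pos _ _ (inv_pos.2 (norm_pos_iff.2 hy0))] at hyw
  refine ⟨w, hw, hwn, ?_⟩
  have := InnerProductGeometry.angle_le_angle_add_angle x y w
  linarith

end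

/-- Lipschitz estimate of angles for general maps:
`|∠(SV, W) − ∠(V, W)| ≤ C‖S − I_d‖` with `C = π/2 + √(π²/4 + 1)`. -/
theorem stmt7 (d s : ℕ) (V W : Submodule ℝ (EuclideanSpace ℝ (Fin d)))
    (hV : finrank ℝ V = s) (hW : finrank ℝ W = s)
    (S : Matrix (Fin d) (Fin d) ℝ) (hSV : finrank ℝ (mapMat S V) = s) :
    |maxAngle (mapMat S V) W - maxAngle V W| ≤
      (π / 2 + Real.sqrt (π ^ 2 / 4 + 1)) * sNorm (S - 1) := by
  have hε0 : 0 ≤ sNorm (S - 1) := norm_nonneg _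
  have hpi := Real.pi_pos
  have hsq := Real.sqrt_nonneg (π ^ 2 / 4 + 1)
  have hC : π / 2 * sNorm (S - 1) ≤ (π / 2 + Real.sqrt (π ^ 2 / 4 + 1)) * sNorm (S - 1) := by
    gcongr; linarith
  rcases Nat.eq_zero_or_pos s with h0 | hs
  · subst h0
    rw [Submodule.finrank_eq_zero] at hV hSV
    rw [hV, ← hV, hSV, hV, sub_self, abs_zero]
    positivity
  have key : ∀ U : Submodule ℝ (EuclideanSpace ℝ (Fin d)), finrank ℝ U = s → U ≠ ⊥ := by
    rintro U hU rfl
    rw [finrank_bot] at hU; omega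
  have hV' := key V hV
  have hW' := key W hW
  have hSV' := key _ hSV
  refine le_trans ?_ hC
  rcases le_or_gt 1 (sNorm (S - 1)) with h1 | h1
  · have a1 := maxAngle_le_half V W hV' hW'
    have a2 := maxAngle_le_half _ W hSV' hW'
    have b1 : 0 ≤ maxAngle V W := Real.arccos_nonneg _
    have b2 : 0 ≤ maxAngle (mapMat S V) W := Real.arccos_nonneg _
    rw [abs_le]
    constructor <;> nlinarith
  have hn : ∀ v : EuclideanSpace ℝ (Fin d),
      ‖v - Matrix.toEuclideanLin S v‖ ≤ sNorm (S - 1) * ‖v‖ := by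
    intro v
    have := (LinearMap.toContinuousLinearMap (Matrix.toEuclideanLin (S - 1))).le_opNorm v
    rw [norm_sub_rev]
    have e : Matrix.toEuclideanLin S v - v =
        LinearMap.toContinuousLinearMap (Matrix.toEuclideanLin (S - 1)) v := by
      rw [LinearMap.coe_toContinuousLinearMap', map_sub, LinearMap.sub_apply]
      congr 1
      simp [Matrix.toEuclideanLin]
    rw [e]
    exact this
  have hne : ∀ v : EuclideanSpace ℝ (Fin d), v ≠ 0 → Matrix.toEuclideanLin S v ≠ 0 := by
    intro v hv h
    have := hn v
    rw [h, sub_zero] at this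
    have := norm_pos_iff.2 hv
    nlinarith
  rw [abs_le]
  constructor
  · have := maxAngle_tri V (mapMat S V) W hV' hW' (π / 2 * sNorm (S - 1)) (by
      intro x hx hx0
      exact ⟨_, Submodule.mem_map_of_mem hx, hne x hx0,
        angle_le_of_near _ _ _ hx0 (hne x hx0) h1 (hn x)⟩)
    linarith
  · have := maxAngle_tri (mapMat S V) V W hSV' hW' (π / 2 * sNorm (S - 1)) (by
      rintro x hx hx0
      obtain ⟨v, hv, rfl⟩ := Submodule.mem_map.1 hx
      have hv0 : v ≠ 0 := by rintro rfl; simp at hx0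
      refine ⟨v, hv, hv0, ?_⟩
      rw [InnerProductGeometry.angle_comm]
      exact angle_le_of_near _ _ _ hv0 hx0 h1 (hn v))
    linarith
end
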